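/- arXiv:0706.0448 — 4 statements merged into one kernel-verified Lean document; each statement's English description precedes it below -/
import Mathlib

section
/- Assume λ_I ≠ 0 for every I ∈ 𝐈, and let Γ be a subgroup of ℤ^n of finite index (equivalently, of rank n) such that {m ∈ ℤ^n : S_{(λ,a)}(m) ≠ 0} = Γ. For each i ∈ {1,…,n} let r_i ≥ 1 be the unique positive integer such that for every k ∈ ℤ one has k·e_i ∈ Γ if and only if r_i divides k. Then: (a) r_i divides N_i for every i; (b) for every i, writing l_i = N_i/r_i and letting ε_i be a primitive r_i-th root of unity, there exist pairwise distinct nonzero complex numbers c_{i1},…,c_{i l_i} and a bijection θ_i : {1,…,l_i} × {1,…,r_i} → {1,…,N_i} such that a_{i,θ_i(t,s)} = ε_i^s · c_{it} for all t, s; and (c) the index [ℤ^n : Γ] divides N = N_1⋯N_n. -/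
open scoped BigOperators

/-- The monomial character `m ↦ ∏ i, x i ^ m i` of `ℤⁿ`. -/
def monomialHom {ι G : Type*} [Fintype ι] [CommGroup G] (x : ι → G) :
    Multiplicative (ι → ℤ) →* G where
  toFun m := ∏ i, x i ^ m.toAdd i
  map_one' := by simp
  map_mul' m m' := by simp [zpow_add, Finset.prod_mul_distrib]

theorem monomialHom_single {ι G : Type*} [Fintype ι] [DecidableEq ι] [CommGroup G]
    (x : ι → G) (i : ι) : monomialHom x (Multiplicative.ofAdd (Pi.single i 1)) = x i := by
  change ∏ j, x j ^ (Pi.single i (1 : ℤ) : ι → ℤ) j = x i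
  rw [Finset.prod_eq_single i (fun j _ hj => by simp [hj]) (by simp)]
  simp

theorem monomialHom_injective {ι G : Type*} [Fintype ι] [CommGroup G] :
    Function.Injective (monomialHom : (ι → G) → Multiplicative (ι → ℤ) →* G) := by
  classical
  intro x y h
  funext i
  rw [← monomialHom_single x i, h, monomialHom_single]

/-- If a combination of characters vanishes off a subgroup, its set of characters is stable under
multiplication by any character trivial on that subgroup. -/
theorem exists_eq_mul_of_sum_support_subset {M K ι : Type*} [CommGroup M] [Field K] [Fintype ι]
    (Λ : Subgroup M) (χ : ι → M →* Kˣ) (hχ : Function.Injective χ) (w : ι → K)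
    (hS : ∀ m, m ∉ Λ → ∑ i, (χ i m : K) * w i = 0)
    (φ : M →* Kˣ) (hφ : ∀ m ∈ Λ, φ m = 1) (i : ι) (hi : w i ≠ 0) :
    ∃ j, χ j = φ * χ i := by
  classical
  by_contra! hne
  have hunits : Function.Injective (fun ψ : M →* Kˣ => (Units.coeHom K).comp ψ) :=
    fun ψ ψ' h => MonoidHom.ext fun m => Units.ext (DFunLike.congr_fun h m)
  have hli := (linearIndependent_monoidHom M K).comp _ hunits
  have heq : (∑ j, Finsupp.single (χ j) (w j)) = ∑ j, Finsupp.single (φ * χ j) (w j) := by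
    apply hli
    funext m
    simp only [map_sum, Finsupp.linearCombination_single, Finset.sum_apply, Pi.smul_apply,
      Function.comp_apply, MonoidHom.comp_apply, Units.coeHom_apply, smul_eq_mul,
      MonoidHom.mul_apply, Units.val_mul]
    by_cases hm : m ∈ Λ
    · simp [hφ m hm]
    · have h := hS m hm
      simp only [mul_comm] at h
      have h' : ∀ j, w j * ((φ m : K) * (χ j m : K)) = (φ m : K) * (w j * (χ j m : K)) :=
        fun j => by ring
      simp only [h', ← Finset.mul_sum, h, mul_zero]
  have h := DFunLike.congr_fun heq (φ * χ i)
  simp [Finsupp.finsetSum_apply, Finsupp.single_apply, hne, hχ.eq_iff] at h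
  exact hi h.symm

/-- A finite subset of a group stable under translation by a subgroup has cardinality divisible by
that of the subgroup. -/
theorem Subgroup.card_dvd_of_mul_stable {G ι : Type*} [CommGroup G] (H : Subgroup G)
    (χ : ι → G) (hχ : Function.Injective χ) (hH : ∀ h ∈ H, ∀ i, ∃ j, χ j = h * χ i) :
    Nat.card H ∣ Nat.card ι := by
  have hP : QuotientGroup.mk (s := H) ⁻¹' (QuotientGroup.mk (s := H) '' Set.range χ)
      = Set.range χ := by
    refine Set.Subset.antisymm ?_ (Set.subset_preimage_image _ _)
    rintro x ⟨_, ⟨i, rfl⟩, hx⟩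
    obtain ⟨j, hj⟩ := hH _ (QuotientGroup.eq.1 hx) i
    exact ⟨j, by rw [hj, mul_comm, mul_inv_cancel_left]⟩
  have hcard := Nat.card_congr (QuotientGroup.preimageMkEquivSubgroupProdSet H
    (QuotientGroup.mk (s := H) '' Set.range χ))
  rw [hP, Nat.card_prod, Nat.card_range_of_injective hχ] at hcard
  exact ⟨_, hcard⟩

/-- A prescribed value at `g` extends to a character trivial on a finite-index subgroup. -/
theorem exists_monoidHom_trivial_on_apply_eq {M : Type*} [CommGroup M] (Λ : Subgroup M)
    [Finite (M ⧸ Λ)] (g : M) (ε : ℂˣ) (h : ∀ k : ℕ, g ^ k ∈ Λ → ε ^ k = 1) :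
    ∃ φ : M →* ℂˣ, (∀ m ∈ Λ, φ m = 1) ∧ φ g = ε := by
  let q : M ⧸ Λ := g
  let q' : Subgroup.zpowers q := ⟨q, Subgroup.mem_zpowers q⟩
  have hq : ∀ x, x ∈ Subgroup.zpowers q' := by
    rintro ⟨x, k, rfl⟩
    exact ⟨k, by ext; simp [q']⟩
  have hord : orderOf ε ∣ orderOf q' := by
    refine orderOf_dvd_of_pow_eq_one (h _ ((QuotientGroup.eq_one_iff _).1 ?_))
    rw [QuotientGroup.mk_pow, Subgroup.orderOf_mk]
    exact pow_orderOf_eq_one q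
  obtain ⟨ψ, hψ⟩ := MonoidHom.domRestrict_surjective ℂ (Subgroup.zpowers q)
    (monoidHomOfForallMemZpowers hq hord)
  refine ⟨ψ.comp (QuotientGroup.mk' Λ), fun m hm => ?_, ?_⟩
  · simp [(QuotientGroup.eq_one_iff m).2 hm]
  · have := DFunLike.congr_fun hψ q'
    rwa [monoidHomOfForallMemZpowers_apply_gen] at this

/-- The characters trivial on a finite-index subgroup form a group of order its index. -/
theorem card_range_compHom'_mk' {M : Type*} [CommGroup M] (Λ : Subgroup M) [Finite (M ⧸ Λ)] :
    Nat.card (MonoidHom.compHom' (P := ℂˣ) (QuotientGroup.mk' Λ)).range = Λ.index := by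
  have hinj : Function.Injective (MonoidHom.compHom' (P := ℂˣ) (QuotientGroup.mk' Λ)) :=
    fun ψ ψ' h => (MonoidHom.cancel_right (QuotientGroup.mk'_surjective Λ)).1 h
  rw [← Nat.card_congr (MonoidHom.ofInjective hinj).toEquiv,
    CommGroup.card_monoidHom_of_hasEnoughRootsOfUnity, Subgroup.index]

/-- A finite set of nonzero elements stable under multiplication by a primitive `r`-th root of unity
is a disjoint union of cosets of the group of `r`-th roots of unity. -/
theorem IsPrimitiveRoot.exists_equiv_of_mul_stable {K : Type*} [Field K] {N r : ℕ} (hr : 0 < r)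
    {ε : K} (hε : IsPrimitiveRoot ε r) (a : Fin N → K) (ha0 : ∀ j, a j ≠ 0)
    (ha : Function.Injective a) (hstab : ∀ j, ∃ k, a k = ε * a j) :
    r ∣ N ∧ ∃ c : Fin (N / r) → K, (∀ t, c t ≠ 0) ∧ Function.Injective c ∧
      ∃ θ : (Fin (N / r) × Fin r) ≃ Fin N,
        ∀ (t : Fin (N / r)) (s : Fin r), a (θ (t, s)) = ε ^ ((s : ℕ) + 1) * c t := by
  have : NeZero r := ⟨hr.ne'⟩
  have hpow : ∀ (s : ℕ) j, ∃ k, a k = ε ^ s * a j := by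
    intro s j
    induction s with
    | zero => exact ⟨j, by simp⟩
    | succ s ih =>
      obtain ⟨k, hk⟩ := ih
      obtain ⟨l, hl⟩ := hstab k
      exact ⟨l, by rw [hl, hk]; ring⟩
  let W := Set.range fun j => a j ^ r
  choose p hp using fun w : W => w.2
  choose f hf using fun x : W × Fin r => hpow (x.2 + 1) (p x.1)
  have hfr : ∀ x, a (f x) ^ r = x.1 := by
    intro x
    rw [hf, mul_pow, ← pow_mul, mul_comm _ r, pow_mul, hε.pow_eq_one, one_pow, one_mul]
    exact hp x.1
  have hbij : Function.Bijective f := by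
    constructor
    · rintro ⟨w, s⟩ ⟨w', s'⟩ h
      obtain rfl : w = w' := Subtype.ext (by rw [← hfr (w, s), h, hfr])
      have h' := (hf (w, s)).symm.trans ((congrArg a h).trans (hf (w, s')))
      have h'' := mul_right_cancel₀ (ha0 _) h'
      rw [pow_succ, pow_succ] at h''
      have := hε.pow_inj s.2 s'.2 (mul_right_cancel₀ (hε.ne_zero hr.ne') h'')
      rw [Fin.ext this]
    · intro j
      let w : W := ⟨a j ^ r, j, rfl⟩
      have hone : (a j / (ε * a (p w))) ^ r = 1 := by
        rw [div_pow, mul_pow, hε.pow_eq_one, one_mul]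
        have : a (p w) ^ r = a j ^ r := hp w
        rw [this, div_self (pow_ne_zero _ (ha0 j))]
      obtain ⟨s, hs, hs'⟩ := hε.eq_pow_of_pow_eq_one hone
      refine ⟨(w, ⟨s, hs⟩), ha ?_⟩
      rw [hf]
      have h1 := ha0 (p w)
      have h2 := hε.ne_zero hr.ne'
      rw [eq_div_iff (mul_ne_zero h2 h1)] at hs'
      rw [← hs']
      ring
  have hcard : Nat.card W * r = N := by
    simpa [Nat.card_prod] using Nat.card_congr (Equiv.ofBijective f hbij)
  have hdiv : Nat.card W = N / r := by rw [← hcard, Nat.mul_div_cancel _ hr]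
  let e : Fin (N / r) ≃ W := (finCongr hdiv.symm).trans (Finite.equivFin W).symm
  refine ⟨⟨_, by rw [mul_comm]; exact hcard.symm⟩, fun t => a (p (e t)), fun t => ha0 _, ?_,
    (e.prodCongr (Equiv.refl _)).trans (Equiv.ofBijective f hbij), fun t s => hf (e t, s)⟩
  intro t t' h
  refine e.injective (Subtype.ext ?_)
  rw [← hp, ← hp]
  exact congrArg (· ^ r) h

/-- Theorem 3.3 of the paper (numerical content): if the support of
`m ↦ S_{(λ,a)}(m)` is a finite-index subgroup `Γ` of `ℤⁿ`, then each `r i`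
(the generator of `pr_i(Γ) ∩ Γ`) divides `N i`, the `a i` have the
root-of-unity structure, and the index of `Γ` divides `N = ∏ N i`. -/
theorem multiloop_image_structure
    (n d : ℕ) (hn : 0 < n) (hd : 0 < d)
    (N : Fin n → ℕ) (hN : ∀ i, 0 < N i)
    (a : (i : Fin n) → Fin (N i) → ℂ)
    (ha0 : ∀ i j, a i j ≠ 0)
    (hainj : ∀ i, Function.Injective (a i))
    (lam : ((i : Fin n) → Fin (N i)) → Fin d → ℕ)
    (hlam : ∀ I, lam I ≠ 0)
    (Γ : AddSubgroup (Fin n → ℤ)) (hΓ : Γ.index ≠ 0)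
    (hset : {m : Fin n → ℤ |
        (∑ I : (i : Fin n) → Fin (N i),
          (∏ i, a i (I i) ^ m i) • (fun j => (lam I j : ℂ))) ≠ 0}
      = (Γ : Set (Fin n → ℤ)))
    (r : Fin n → ℕ) (hr : ∀ i, 1 ≤ r i)
    (hrΓ : ∀ (i : Fin n) (k : ℤ), Pi.single i k ∈ Γ ↔ (r i : ℤ) ∣ k)
    (ε : Fin n → ℂ) (hε : ∀ i, IsPrimitiveRoot (ε i) (r i)) :
    (∀ i, r i ∣ N i) ∧
    (∀ i, ∃ c : Fin (N i / r i) → ℂ,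
      (∀ t, c t ≠ 0) ∧ Function.Injective c ∧
      ∃ θ : (Fin (N i / r i) × Fin (r i)) ≃ Fin (N i),
        ∀ (t : Fin (N i / r i)) (s : Fin (r i)),
          a i (θ (t, s)) = ε i ^ ((s : ℕ) + 1) * c t) ∧
    Γ.index ∣ ∏ i, N i := by
  let Λ : Subgroup (Multiplicative (Fin n → ℤ)) := AddSubgroup.toSubgroup Γ
  have hindex : Λ.index = Γ.index := AddSubgroup.index_toSubgroup Γ
  have : Finite (Multiplicative (Fin n → ℤ) ⧸ Λ) :=
    Subgroup.index_ne_zero_iff_finite.1 (hindex ▸ hΓ)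
  let χ : ((i : Fin n) → Fin (N i)) → Multiplicative (Fin n → ℤ) →* ℂˣ :=
    fun I => monomialHom fun i => Units.mk0 (a i (I i)) (ha0 i (I i))
  have hχ : Function.Injective χ := by
    intro I J h
    funext i
    exact hainj i (congrArg Units.val (congrFun (monomialHom_injective h) i))
  have hstab : ∀ φ : Multiplicative (Fin n → ℤ) →* ℂˣ, (∀ m ∈ Λ, φ m = 1) →
      ∀ I, ∃ J, χ J = φ * χ I := by
    intro φ hφ I
    obtain ⟨k, hk⟩ := Function.ne_iff.1 (hlam I)
    refine exists_eq_mul_of_sum_support_subset Λ χ hχ (fun I => (lam I k : ℂ)) ?_ φ hφ I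
      (Nat.cast_ne_zero.2 hk)
    intro m hm
    have hm' : m.toAdd ∉ (Γ : Set (Fin n → ℤ)) := hm
    rw [← hset, Set.mem_ofPred_eq, not_not] at hm'
    simpa [χ, monomialHom] using congrFun hm' k
  have hroot : ∀ i j, ∃ k, a i k = ε i * a i j := by
    intro i j
    have hε0 := (hε i).ne_zero (Nat.one_le_iff_ne_zero.1 (hr i))
    obtain ⟨φ, hφ, hφi⟩ := exists_monoidHom_trivial_on_apply_eq Λ
      (Multiplicative.ofAdd (Pi.single i 1)) (Units.mk0 (ε i) hε0) (by
        intro k hk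
        have hk' : k • (Pi.single i 1 : Fin n → ℤ) ∈ Γ := hk
        rw [← Pi.single_smul, nsmul_eq_mul, mul_one, hrΓ, Int.natCast_dvd_natCast] at hk'
        ext
        simpa using ((hε i).pow_eq_one_iff_dvd k).2 hk')
    let I : (i : Fin n) → Fin (N i) := Function.update (fun k => ⟨0, hN k⟩) i j
    obtain ⟨J, hJ⟩ := hstab φ hφ I
    have h := DFunLike.congr_fun hJ (Multiplicative.ofAdd (Pi.single i 1))
    rw [MonoidHom.mul_apply, hφi, monomialHom_single, monomialHom_single] at h
    exact ⟨J i, by simpa [I] using congrArg Units.val h⟩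
  have hcoset := fun i =>
    (hε i).exists_equiv_of_mul_stable (hr i) (a i) (ha0 i) (hainj i) (hroot i)
  refine ⟨fun i => (hcoset i).1, fun i => (hcoset i).2, ?_⟩
  have hdvd := Subgroup.card_dvd_of_mul_stable
    (MonoidHom.compHom' (P := ℂˣ) (QuotientGroup.mk' Λ)).range χ hχ (by
      rintro _ ⟨ψ, rfl⟩
      refine hstab _ fun m hm => ?_
      simp [(QuotientGroup.eq_one_iff m).2 hm])
  rw [card_range_compHom'_mk', hindex] at hdvd
  simpa using hdvd
end

section
/- Assume λ_I ≠ 0 for every I ∈ 𝐈, and let Γ be a subgroup of ℤ^n of finite index such that {m ∈ ℤ^n : S_{(λ,a)}(m) ≠ 0} = Γ. Set p = [ℤ^n : Γ] and N = N_1⋯N_n. Then p divides N, and there exists a partition of the index set 𝐈 into N/p classes, each of cardinality exactly p, such that λ is constant on each class (i.e. the weights λ_I are equal in sets of [ℤ^n : Γ]). -/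
open scoped BigOperators

/-- A finite sum of characters that vanishes wherever `η ≠ 1` is invariant under
multiplication by `η`; this compares the coefficients of `χ i * η`. -/
theorem AddChar.coeff_eq_sum_of_vanish {A ι F : Type*} [AddCommGroup A] [Field F] [Fintype ι]
    (χ : ι → AddChar A F) (hχ : Function.Injective χ) (η : AddChar A F) (c : ι → F)
    (h : ∀ m, η m ≠ 1 → ∑ i, c i * χ i m = 0) (i : ι) :
    c i = ∑ j, (Finsupp.single (χ j) (c j) : AddChar A F →₀ F) (χ i * η) := by
  classical
  have key : (∑ j, Finsupp.single (χ j * η) (c j) : AddChar A F →₀ F)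
      = ∑ j, Finsupp.single (χ j) (c j) := by
    have hli : LinearIndependent F (fun φ : AddChar A F => (φ : A → F)) :=
      (linearIndependent_monoidHom (Multiplicative A) F).comp _
        (AddChar.toMonoidHomEquiv (A := A) (M := F)).injective
    apply hli
    ext m
    simp only [map_sum, Finsupp.linearCombination_single, Finset.sum_apply, Pi.smul_apply,
      smul_eq_mul, AddChar.mul_apply]
    by_cases hm : η m = 1
    · simp [hm]
    · simp only [← mul_assoc, ← Finset.sum_mul, h m hm, zero_mul]
  have hi := DFunLike.congr_fun key (χ i * η)
  rw [Finsupp.finsetSum_apply, Finsupp.finsetSum_apply] at hi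
  rw [← hi]
  have hinj (j : ι) : χ j * η = χ i * η ↔ j = i :=
    (mul_left_injective η).eq_iff.trans hχ.eq_iff
  simp only [Finsupp.single_apply, hinj, Finset.sum_ite_eq', Finset.mem_univ, if_true]

/-- If all fibres of `g` through points of `T` have `p` elements, then `T` can be partitioned
into `card T / p` classes of size `p` on which `g` is constant. -/
theorem exists_partition_of_card_fiber_eq {T Q : Type*} [Fintype T] (g : T → Q) (p : ℕ)
    (hp : p ≠ 0) (hg : ∀ x, Nat.card {y // g y = g x} = p) :
    p ∣ Nat.card T ∧ ∃ f : T → Fin (Nat.card T / p),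
      (∀ k, Nat.card {x // f x = k} = p) ∧ ∀ x y, f x = f y → g x = g y := by
  classical
  have hfib (q : Set.range g) : Nat.card {y // Set.rangeFactorization g y = q} = p := by
    obtain ⟨_, x, rfl⟩ := q
    rw [← hg x]
    exact Nat.card_congr (Equiv.subtypeEquivRight fun y => Subtype.ext_iff)
  have hcard : Nat.card T = Nat.card (Set.range g) * p := by
    rw [← Nat.card_congr (Equiv.sigmaFiberEquiv (Set.rangeFactorization g)), Nat.card_sigma]
    simp only [hfib]
    simp
  have hdiv : Nat.card (Set.range g) = Nat.card T / p := by
    rw [hcard, Nat.mul_div_cancel _ (Nat.pos_of_ne_zero hp)]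
  let e : Set.range g ≃ Fin (Nat.card T / p) := Finite.equivFinOfCardEq hdiv
  refine ⟨⟨_, hcard.trans (mul_comm _ _)⟩, fun x => e (Set.rangeFactorization g x),
    fun k => ?_, fun x y hxy => ?_⟩
  · refine Eq.trans ?_ (hfib (e.symm k))
    exact Nat.card_congr (Equiv.subtypeEquivRight fun y => e.eq_symm_apply.symm)
  · exact congrArg Subtype.val (e.injective hxy)

/-- The character `m ↦ ∏ i, z i ^ m i` of `ℤⁿ`. -/
noncomputable def zpowAddChar {n : ℕ} (z : Fin n → ℂ) (hz : ∀ i, z i ≠ 0) :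
    AddChar (Fin n → ℤ) ℂ where
  toFun m := ∏ i, z i ^ m i
  map_zero_eq_one' := by simp
  map_add_eq_mul' m m' := by simp [zpow_add₀ (hz _), Finset.prod_mul_distrib]

theorem zpowAddChar_single {n : ℕ} (z : Fin n → ℂ) (hz : ∀ i, z i ≠ 0) (i : Fin n) :
    zpowAddChar z hz (Pi.single i 1) = z i := by
  change ∏ j, z j ^ (Pi.single i 1 : Fin n → ℤ) j = z i
  rw [Finset.prod_eq_single i] <;> simp +contextual

/-- Pullback of characters along `A → A ⧸ Γ`. -/
def AddChar.quotientPullback {A : Type*} [AddCommGroup A] (Γ : AddSubgroup A) :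
    AddChar (A ⧸ Γ) ℂ →* AddChar A ℂ where
  toFun ψ := ψ.compAddMonoidHom (QuotientAddGroup.mk' Γ)
  map_one' := rfl
  map_mul' _ _ := rfl

theorem AddChar.quotientPullback_injective {A : Type*} [AddCommGroup A] (Γ : AddSubgroup A) :
    Function.Injective (AddChar.quotientPullback Γ) := by
  intro ψ φ h
  ext x
  obtain ⟨m, rfl⟩ := QuotientAddGroup.mk'_surjective Γ x
  exact DFunLike.congr_fun h m

theorem AddChar.card_range_quotientPullback {A : Type*} [AddCommGroup A] (Γ : AddSubgroup A)
    (hΓ : Γ.index ≠ 0) : Nat.card (AddChar.quotientPullback Γ).range = Γ.index := by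
  have : Γ.FiniteIndex := ⟨hΓ⟩
  have := Fintype.ofFinite (A ⧸ Γ)
  rw [Nat.card_congr (MonoidHom.ofInjective (quotientPullback_injective Γ)).symm.toEquiv,
    Nat.card_eq_fintype_card, AddChar.card_eq, ← Nat.card_eq_fintype_card]
  rfl

theorem AddChar.quotientPullback_eq_one {A : Type*} [AddCommGroup A] (Γ : AddSubgroup A)
    (ψ : AddChar (A ⧸ Γ) ℂ) {m : A} (hm : m ∈ Γ) : quotientPullback Γ ψ m = 1 := by
  change ψ (m : A ⧸ Γ) = 1
  rw [(QuotientAddGroup.eq_zero_iff m).2 hm, AddChar.map_zero_eq_one]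

/-- From the proof of Theorem 3.3: if the support of `m ↦ S_{(λ,a)}(m)` is a
finite-index subgroup `Γ` of `ℤⁿ` with index `p`, then `p ∣ N` and the index
set `𝐈` can be partitioned into `N / p` classes, each of cardinality `p`, on
each of which `λ` is constant. -/
theorem multiloop_weights_equal_in_sets
    (n d : ℕ) (hn : 0 < n) (hd : 0 < d)
    (N : Fin n → ℕ) (hN : ∀ i, 0 < N i)
    (a : (i : Fin n) → Fin (N i) → ℂ)
    (ha0 : ∀ i j, a i j ≠ 0)
    (hainj : ∀ i, Function.Injective (a i))
    (lam : ((i : Fin n) → Fin (N i)) → Fin d → ℕ)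
    (hlam : ∀ I, lam I ≠ 0)
    (Γ : AddSubgroup (Fin n → ℤ)) (hΓ : Γ.index ≠ 0)
    (hset : {m : Fin n → ℤ |
        (∑ I : (i : Fin n) → Fin (N i),
          (∏ i, a i (I i) ^ m i) • (fun j => (lam I j : ℂ))) ≠ 0}
      = (Γ : Set (Fin n → ℤ))) :
    Γ.index ∣ ∏ i, N i ∧
    ∃ f : ((i : Fin n) → Fin (N i)) → Fin ((∏ i, N i) / Γ.index),
      (∀ k, Fintype.card {I : (i : Fin n) → Fin (N i) // f I = k} = Γ.index) ∧
      (∀ I J, f I = f J → lam I = lam J) := by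
  classical
  let χ : ((i : Fin n) → Fin (N i)) → AddChar (Fin n → ℤ) ℂ :=
    fun I => zpowAddChar (fun i => a i (I i)) fun i => ha0 i (I i)
  have hχ : Function.Injective χ := by
    intro I J h
    funext i
    apply hainj i
    simpa only [χ, zpowAddChar_single] using DFunLike.congr_fun h (Pi.single i 1)
  let K := (AddChar.quotientPullback Γ).range
  have hcoeff (η : K) (I) (j) : (lam I j : ℂ)
      = ∑ J, (Finsupp.single (χ J) (lam J j : ℂ) : _ →₀ ℂ) (χ I * η) := by
    refine AddChar.coeff_eq_sum_of_vanish χ hχ η (fun J => (lam J j : ℂ)) (fun m hm => ?_) I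
    have hmΓ : m ∉ (Γ : Set (Fin n → ℤ)) := by
      obtain ⟨_, ψ, rfl⟩ := η
      exact fun h => hm (AddChar.quotientPullback_eq_one Γ ψ h)
    rw [← hset, Set.mem_ofPred_eq, not_not] at hmΓ
    have := congrFun hmΓ j
    simp only [Finset.sum_apply, Pi.smul_apply, smul_eq_mul, Pi.zero_apply] at this
    rw [← this]
    exact Finset.sum_congr rfl fun J _ => mul_comm _ _
  have hlamEq (η : K) (I J) (h : χ J = χ I * η) : lam I = lam J := by
    funext j
    have := hcoeff η I j
    simp only [← h, Finsupp.single_apply, hχ.eq_iff, Finset.sum_ite_eq', Finset.mem_univ,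
      if_true] at this
    exact_mod_cast this
  have hex (η : K) (I) : ∃ J, χ J = χ I * η := by
    obtain ⟨j, hj⟩ := Function.ne_iff.1 (hlam I)
    by_contra! hne
    have := hcoeff η I j
    rw [Finset.sum_eq_zero fun J _ => Finsupp.single_eq_of_ne (hne J).symm] at this
    exact hj (by exact_mod_cast this)
  let g : ((i : Fin n) → Fin (N i)) → AddChar (Fin n → ℤ) ℂ ⧸ K := fun I => (χ I : _ ⧸ K)
  have hg (I) : Nat.card {J // g J = g I} = Γ.index := by
    rw [← AddChar.card_range_quotientPullback Γ hΓ]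
    refine Nat.card_congr (Equiv.ofBijective
      (fun J => (⟨(χ I)⁻¹ * χ J, QuotientGroup.eq.1 J.2.symm⟩ : K)) ⟨fun J J' h => ?_, fun η => ?_⟩)
    · exact Subtype.ext (hχ (mul_left_cancel (congrArg Subtype.val h)))
    · obtain ⟨J, hJ⟩ := hex η I
      have hJ' : (χ I)⁻¹ * χ J = η := by rw [hJ, inv_mul_cancel_left]
      exact ⟨⟨J, (QuotientGroup.eq.2 (hJ' ▸ η.2)).symm⟩, Subtype.ext hJ'⟩
  have hN' : Nat.card ((i : Fin n) → Fin (N i)) = ∏ i, N i := by simp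
  obtain ⟨hdvd, f, hf, hfg⟩ := exists_partition_of_card_fiber_eq g _ hΓ hg
  rw [hN'] at hdvd
  rw [← hN']
  refine ⟨hN' ▸ hdvd, f, fun k => ?_, fun I J h => ?_⟩
  · exact Nat.card_eq_fintype_card.symm.trans (hf k)
  · exact hlamEq ⟨_, QuotientGroup.eq.1 (hfg I J h)⟩ I J (mul_inv_cancel_left _ _).symm
end

section
/- Assume λ_I ∈ ℕ^d for all I ∈ 𝐈 and that not all λ_I are zero. Then: (i) for each i ∈ {1,…,n} there exists an integer k with 1 ≤ k ≤ N_i such that S_{(λ,a)}(k·e_i) ≠ 0; (ii) consequently, if the set Γ = {m ∈ ℤ^n : S_{(λ,a)}(m) ≠ 0} is a subgroup of ℤ^n, then Γ has finite index in ℤ^n, i.e. Γ is a subgroup of ℤ^n of rank n. -/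
open scoped BigOperators

/-- A subgroup of `ℤ^ι` containing a positive multiple of each standard basis vector has finite
index. -/
theorem AddSubgroup.index_ne_zero_of_single_mem {ι : Type*} [Finite ι] [DecidableEq ι]
    (Γ : AddSubgroup (ι → ℤ)) (h : ∀ i, ∃ k : ℤ, 1 ≤ k ∧ Pi.single i k ∈ Γ) :
    Γ.index ≠ 0 := by
  cases nonempty_fintype ι
  have htors : IsAddTorsion ((ι → ℤ) ⧸ Γ) := by
    intro q
    obtain ⟨x, rfl⟩ := QuotientAddGroup.mk'_surjective Γ q
    change _ ∈ AddCommGroup.torsion ((ι → ℤ) ⧸ Γ)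
    rw [← Finset.univ_sum_single x, map_sum]
    refine sum_mem fun i _ => ?_
    obtain ⟨k, hk, hmem⟩ := h i
    change IsOfFinAddOrder _
    refine isOfFinAddOrder_iff_zsmul_eq_zero.mpr ⟨k, by lia, ?_⟩
    rw [← map_zsmul, QuotientAddGroup.mk'_apply, QuotientAddGroup.eq_zero_iff]
    convert Γ.zsmul_mem hmem (x i) using 1
    rw [← Pi.single_smul, ← Pi.single_smul, smul_eq_mul, smul_eq_mul, mul_comm]
  have : AddGroup.FG ((ι → ℤ) ⧸ Γ) := inferInstance
  have := AddCommGroup.finite_of_fg_isAddTorsion _ htors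
  exact AddSubgroup.index_ne_zero_of_finite

/-- A nonzero weight on finitely many distinct nonzero points has a nonzero power sum of some
exponent between `1` and the number of points. -/
theorem exists_sum_mul_pow_ne_zero {R : Type*} [CommRing R] [IsDomain R] {N : ℕ}
    {f v : Fin N → R} (hf : Function.Injective f) (hf0 : ∀ p, f p ≠ 0) (hv : v ≠ 0) :
    ∃ k : ℕ, 1 ≤ k ∧ k ≤ N ∧ ∑ p, v p * f p ^ k ≠ 0 := by
  by_contra! hzero
  have hvf : (fun p => v p * f p) = 0 := by
    refine Matrix.eq_zero_of_forall_pow_sum_mul_pow_eq_zero hf fun m => ?_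
    rw [← hzero (m + 1) (by lia) (by lia)]
    exact Finset.sum_congr rfl fun p _ => by ring
  exact hv (funext fun p => (mul_eq_zero.mp (congrFun hvf p)).resolve_right (hf0 p))

/-- Lemma 3.2 of the paper (numerical content): if the dominant integral
weights `λ_I` are not all zero then for each `i` some `S_{(λ,a)}(k·e_i)` with
`1 ≤ k ≤ N_i` is nonzero; consequently, if the support of `S_{(λ,a)}` is a
subgroup `Γ` of `ℤⁿ`, then `Γ` has finite index (i.e. rank `n`). -/
theorem multiloop_support_rank
    (n d : ℕ) (hn : 0 < n) (hd : 0 < d)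
    (N : Fin n → ℕ) (hN : ∀ i, 0 < N i)
    (a : (i : Fin n) → Fin (N i) → ℂ)
    (ha0 : ∀ i j, a i j ≠ 0)
    (hainj : ∀ i, Function.Injective (a i))
    (lam : ((i : Fin n) → Fin (N i)) → Fin d → ℕ)
    (hlam : ∃ I, lam I ≠ 0) :
    (∀ i : Fin n, ∃ k : ℤ, 1 ≤ k ∧ k ≤ (N i : ℤ) ∧
      (∑ I : (i' : Fin n) → Fin (N i'),
        (∏ i', a i' (I i') ^ (Pi.single i k : Fin n → ℤ) i') •
          (fun j => (lam I j : ℂ))) ≠ 0) ∧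
    (∀ Γ : AddSubgroup (Fin n → ℤ),
      (Γ : Set (Fin n → ℤ)) = {m : Fin n → ℤ |
        (∑ I : (i' : Fin n) → Fin (N i'),
          (∏ i', a i' (I i') ^ m i') • (fun j => (lam I j : ℂ))) ≠ 0} →
      Γ.index ≠ 0) := by
  have axis_ne_zero : ∀ i : Fin n, ∃ k : ℤ, 1 ≤ k ∧ k ≤ (N i : ℤ) ∧
      (∑ I : (i' : Fin n) → Fin (N i'),
        (∏ i', a i' (I i') ^ (Pi.single i k : Fin n → ℤ) i') •
          (fun j => (lam I j : ℂ))) ≠ 0 := by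
    intro i
    obtain ⟨I₀, hI₀⟩ := hlam
    obtain ⟨j, hj⟩ := Function.ne_iff.mp hI₀
    let v : Fin (N i) → ℂ := fun p =>
      ((∑ I : (i' : Fin n) → Fin (N i') with I i = p, lam I j : ℕ) : ℂ)
    have hv : v ≠ 0 := by
      refine Function.ne_iff.mpr ⟨I₀ i, Nat.cast_ne_zero.mpr fun h => hj ?_⟩
      exact Finset.sum_eq_zero_iff.mp h I₀ (by simp)
    obtain ⟨k, hk1, hkN, hk⟩ := exists_sum_mul_pow_ne_zero (hainj i) (ha0 i) hv
    refine ⟨k, by exact_mod_cast hk1, by exact_mod_cast hkN, fun hsum => hk ?_⟩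
    have hprod (I : (i' : Fin n) → Fin (N i')) :
        ∏ i', a i' (I i') ^ (Pi.single i (k : ℤ) : Fin n → ℤ) i' = a i (I i) ^ k := by
      rw [Finset.prod_eq_single i (fun b _ hb => by simp [hb]) (by simp)]
      simp
    have hsum_j := congrFun hsum j
    simp only [hprod, Finset.sum_apply, Pi.smul_apply, smul_eq_mul, Pi.zero_apply] at hsum_j
    rw [← hsum_j, ← Finset.sum_fiberwise _ (fun I : (i' : Fin n) → Fin (N i') => I i)]
    refine Finset.sum_congr rfl fun p _ => ?_
    simp only [v, Nat.cast_sum, Finset.sum_mul]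
    refine Finset.sum_congr rfl fun I hI => ?_
    rw [(Finset.mem_filter.mp hI).2, mul_comm]
  refine ⟨axis_ne_zero, fun Γ hΓ => Γ.index_ne_zero_of_single_mem fun i => ?_⟩
  obtain ⟨k, hk, -, hne⟩ := axis_ne_zero i
  refine ⟨k, hk, ?_⟩
  rw [← SetLike.mem_coe, hΓ]
  exact hne
end

section
/- Fix an integer k ≥ 2. Let V_0,…,V_{k−1} be complex vector spaces and for each j ∈ {0,…,k−1} let λ^j : 𝐈 → V_j be a family of vectors; for m = (m_1,…,m_n) ∈ ℤ^n define the twisted sum S^μ_{(λ,a)}(m) = Σ_{I∈𝐈} a_I^m λ^{j(m)}_I, where j(m) ∈ {0,…,k−1} is the residue of m_1 modulo k. Suppose given: permutations τ_i of {1,…,N_i} for each i; nonzero complex numbers w and ℘_2,…,℘_n; k-th roots of unity ε_1,…,ε_{N_1}; tuples b_i with b_{1j} = ε_j · w · a_{1τ_1(j)} for 1 ≤ j ≤ N_1 and b_{ij} = ℘_i · a_{iτ_i(j)} for 2 ≤ i ≤ n; and families ξ^j : 𝐈 → V_j defined by ξ^j_{(i_1,…,i_n)} = ε_{i_1}^{−j}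 · λ^j_{(τ_1(i_1),…,τ_n(i_n))}. Then for every m ∈ ℤ^n one has S^μ_{(ξ,b)}(m) = w^{m_1} · (℘_2^{m_2}⋯℘_n^{m_n}) · S^μ_{(λ,a)}(m); in particular the sets {m : S^μ_{(ξ,b)}(m) ≠ 0} and {m : S^μ_{(λ,a)}(m) ≠ 0} coincide. -/
open scoped BigOperators

/-- For a `k`-th root of unity, `x ^ m` is cancelled by the inverse power of the residue of `m`. -/
theorem zpow_mul_zpow_neg_emod_of_pow_eq_one {F : Type*} [Field F] {x : F} {k : ℕ} (hk : k ≠ 0)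
    (hx : x ^ k = 1) (m : ℤ) : x ^ m * x ^ (-((m % (k : ℤ)).toNat : ℤ)) = 1 := by
  have hx0 : x ≠ 0 := by
    rintro rfl
    simp [hk] at hx
  have hk' : (k : ℤ) ≠ 0 := by exact_mod_cast hk
  have hsub : m + -(m % (k : ℤ)) = k * (m / k) := by
    linarith [Int.emod_add_mul_ediv m k]
  rw [Int.toNat_of_nonneg (Int.emod_nonneg m hk'), ← zpow_add₀ hx0, hsub, zpow_mul,
    zpow_natCast, hx, one_zpow]

/-- Splitting off one index, a product of scaled powers is a product of scalars times a product of
powers. -/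
theorem prod_zpow_of_eq_mul {ι F : Type*} [Fintype ι] [DecidableEq ι] [Field F] (i₀ : ι)
    {x y p : ι → F} {e w : F} (h₀ : y i₀ = e * w * x i₀) (h : ∀ i, i ≠ i₀ → y i = p i * x i)
    (m : ι → ℤ) :
    ∏ i, y i ^ m i =
      e ^ m i₀ * ((w ^ m i₀ * ∏ i ∈ Finset.univ.filter (fun i => i ≠ i₀), p i ^ m i) *
        ∏ i, x i ^ m i) := by
  have hy : ∏ i ∈ Finset.univ.erase i₀, y i ^ m i =
      (∏ i ∈ Finset.univ.erase i₀, p i ^ m i) * ∏ i ∈ Finset.univ.erase i₀, x i ^ m i := by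
    rw [← Finset.prod_mul_distrib]
    refine Finset.prod_congr rfl fun i hi => ?_
    rw [h i (Finset.ne_of_mem_erase hi), mul_zpow]
  rw [Finset.filter_ne', ← Finset.mul_prod_erase _ _ (Finset.mem_univ i₀),
    ← Finset.mul_prod_erase _ (fun i => x i ^ m i) (Finset.mem_univ i₀), hy, h₀, mul_zpow,
    mul_zpow]
  ring

/-- Computational core of the sufficiency direction of Theorem 4.7 (twisted
case): with `j(m)` the residue of `m₁` mod `k`, if `b` is obtained from `a`
by permutations, a global scalar `w` twisted by `k`-th roots of unity `ε_j`
in the first variable, and scalars `℘_i` in the other variables, and the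
restricted weights are twisted accordingly, then
`S^μ_{(ξ,b)}(m) = w^{m₁}·(∏_{i≥2} ℘_i^{m_i}) • S^μ_{(λ,a)}(m)`;
in particular the supports coincide. -/
theorem twisted_multiloop_psi_rescale_permute
    (n : ℕ) (hn : 0 < n)
    (N : Fin n → ℕ) (hN : ∀ i, 0 < N i)
    (a : (i : Fin n) → Fin (N i) → ℂ)
    (ha0 : ∀ i j, a i j ≠ 0)
    (hainj : ∀ i, Function.Injective (a i))
    (k : ℕ) (hk : 2 ≤ k)
    (V : ℕ → Type*) [∀ j, AddCommGroup (V j)] [∀ j, Module ℂ (V j)]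
    (lam : (j : ℕ) → ((i : Fin n) → Fin (N i)) → V j)
    (τ : (i : Fin n) → Equiv.Perm (Fin (N i)))
    (w : ℂ) (hw : w ≠ 0)
    (p : Fin n → ℂ) (hp : ∀ i : Fin n, i ≠ ⟨0, hn⟩ → p i ≠ 0)
    (ε : Fin (N ⟨0, hn⟩) → ℂ) (hε : ∀ j, ε j ^ k = 1)
    (b : (i : Fin n) → Fin (N i) → ℂ)
    (hb1 : ∀ j : Fin (N ⟨0, hn⟩), b ⟨0, hn⟩ j = ε j * w * a ⟨0, hn⟩ (τ ⟨0, hn⟩ j))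
    (hbi : ∀ i : Fin n, i ≠ ⟨0, hn⟩ → ∀ j : Fin (N i), b i j = p i * a i (τ i j))
    (xi : (j : ℕ) → ((i : Fin n) → Fin (N i)) → V j)
    (hxi : ∀ (j : ℕ) (I : (i : Fin n) → Fin (N i)),
      xi j I = (ε (I ⟨0, hn⟩)) ^ (-(j : ℤ)) • lam j (fun i => τ i (I i))) :
    (∀ m : Fin n → ℤ,
      (∑ I : (i : Fin n) → Fin (N i),
        (∏ i, b i (I i) ^ m i) • xi ((m ⟨0, hn⟩ % (k : ℤ)).toNat) I)
        = (w ^ (m ⟨0, hn⟩) *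
            ∏ i ∈ Finset.univ.filter (fun i : Fin n => i ≠ ⟨0, hn⟩), p i ^ m i) •
          ∑ I : (i : Fin n) → Fin (N i),
            (∏ i, a i (I i) ^ m i) • lam ((m ⟨0, hn⟩ % (k : ℤ)).toNat) I) ∧
    {m : Fin n → ℤ |
        (∑ I : (i : Fin n) → Fin (N i),
          (∏ i, b i (I i) ^ m i) • xi ((m ⟨0, hn⟩ % (k : ℤ)).toNat) I) ≠ 0}
      = {m : Fin n → ℤ |
        (∑ I : (i : Fin n) → Fin (N i),
          (∏ i, a i (I i) ^ m i) • lam ((m ⟨0, hn⟩ % (k : ℤ)).toNat) I) ≠ 0} := by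
  have key : ∀ m : Fin n → ℤ,
      (∑ I : (i : Fin n) → Fin (N i),
        (∏ i, b i (I i) ^ m i) • xi ((m ⟨0, hn⟩ % (k : ℤ)).toNat) I)
        = (w ^ (m ⟨0, hn⟩) *
            ∏ i ∈ Finset.univ.filter (fun i : Fin n => i ≠ ⟨0, hn⟩), p i ^ m i) •
          ∑ I : (i : Fin n) → Fin (N i),
            (∏ i, a i (I i) ^ m i) • lam ((m ⟨0, hn⟩ % (k : ℤ)).toNat) I := by
    intro m
    rw [Finset.smul_sum]
    refine Fintype.sum_equiv (Equiv.piCongrRight τ) _ _ fun I => ?_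
    have hprod := prod_zpow_of_eq_mul (⟨0, hn⟩ : Fin n) (x := fun i => a i (τ i (I i)))
      (y := fun i => b i (I i)) (p := p) (hb1 _) (fun i hi => hbi i hi _) m
    have hroot := zpow_mul_zpow_neg_emod_of_pow_eq_one (by omega : k ≠ 0)
      (hε (I ⟨0, hn⟩)) (m ⟨0, hn⟩)
    rw [hprod, hxi, smul_smul, mul_right_comm, hroot, one_mul, mul_smul]
    rfl
  refine ⟨key, Set.ext fun m => ?_⟩
  have hc : w ^ (m ⟨0, hn⟩) *
      ∏ i ∈ Finset.univ.filter (fun i : Fin n => i ≠ ⟨0, hn⟩), p i ^ m i ≠ 0 :=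
    mul_ne_zero (zpow_ne_zero _ hw) <| Finset.prod_ne_zero_iff.mpr fun i hi =>
      zpow_ne_zero _ (hp i (Finset.mem_filter.mp hi).2)
  rw [Set.mem_ofPred_eq, Set.mem_ofPred_eq, key m, smul_ne_zero_iff_right hc]
end
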